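/- A feasible lottery allocation (x̃_1,…,x̃_n) is a CERI allocation if and only if there exists a price vector p ∈ ℝ^m with p ≥ 0 such that: (a) p_j = 0 for every good j with Σ_i E[x̃_i]_j < c_j; and (b) for every agent i, every x ∈ Ψ_i with x̃_i(x) > 0, and every y ∈ Ψ_i with y ≻_i x, one has p·(y − x) ≥ 1. -/

import Mathlib

open MeasureTheory Finset

noncomputable section

/-- A bundle of the `m` goods. -/
abbrev Bundle (m : ℕ) := Fin m → ℕ

/-- The price of bundle `x` at price vector `p`. -/
def dotp {m : ℕ} (p : Fin m → ℝ) (x : Bundle m) : ℝ := ∑ j, p j * (x j : ℝ)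

/-- Finitely many real gaps are all scaled to at least `1` by a common nonnegative factor, as far
as they are positive. -/
theorem exists_nonneg_scale_of_finset (s : Finset ℝ) :
    ∃ t : ℝ, 0 ≤ t ∧ ∀ d ∈ s, 0 < d → 1 ≤ t * d := by
  obtain ⟨M, hM⟩ := Finset.exists_le (s.image fun d => d⁻¹)
  refine ⟨max M 0, le_max_right _ _, fun d hd hpos => ?_⟩
  have h : d⁻¹ ≤ max M 0 := (hM _ (Finset.mem_image_of_mem _ hd)).trans (le_max_left _ _)
  calc (1 : ℝ) = d⁻¹ * d := (inv_mul_cancel₀ hpos.ne').symm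
    _ ≤ max M 0 * d := by gcongr

theorem dotp_nonneg {m : ℕ} {p : Fin m → ℝ} (hp : ∀ j, 0 ≤ p j) (x : Bundle m) :
    0 ≤ dotp p x :=
  Finset.sum_nonneg fun j _ => mul_nonneg (hp j) (Nat.cast_nonneg _)

theorem dotp_const_mul {m : ℕ} (t : ℝ) (p : Fin m → ℝ) (x : Bundle m) :
    dotp (fun j => t * p j) x = t * dotp p x := by
  simp [dotp, Finset.mul_sum, mul_assoc]

/-- The finitely supported measure putting mass `w x` on the point `f x`. -/
def weightedDirac {α : Type*} (s : Finset α) (w : α → ℝ) (f : α → ℝ) : Measure ℝ :=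
  ∑ x ∈ s, ENNReal.ofReal (w x) • Measure.dirac (f x)

theorem weightedDirac_apply {α : Type*} (s : Finset α) (w : α → ℝ) (f : α → ℝ) (A : Set ℝ)
    [DecidablePred (· ∈ A)] :
    weightedDirac s w f A = ∑ x ∈ s, if f x ∈ A then ENNReal.ofReal (w x) else 0 := by
  classical
  simp [weightedDirac, Measure.finsetSum_apply, Measure.dirac_apply, Set.indicator_apply]

/-- **Price characterization of CERI allocations**: a feasible lottery allocation is a CERI
allocation if and only if there is a price vector `p ≥ 0` such that (a) `p j = 0` for
every under-allocated good `j`, and (b) for every agent `i`, every bundle `x` consumed with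
positive probability and every bundle `y ≻ᵢ x`, one has `p·(y - x) ≥ 1`. -/
theorem ceri_allocation_iff_prices
    (n m Δ : ℕ) (hΔ : 0 < Δ)
    (c : Fin m → ℕ)
    (Ψ : Fin n → Finset (Bundle m))
    (hzero : ∀ i, (0 : Bundle m) ∈ Ψ i)
    (hsize : ∀ i, ∀ x ∈ Ψ i, ∑ j, x j ≤ Δ)
    (pref : Fin n → Bundle m → Bundle m → Prop)
    (hirr : ∀ i, ∀ x ∈ Ψ i, ¬ pref i x x)
    (htrans : ∀ i, ∀ x ∈ Ψ i, ∀ y ∈ Ψ i, ∀ z ∈ Ψ i,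
        pref i x y → pref i y z → pref i x z)
    (htotal : ∀ i, ∀ x ∈ Ψ i, ∀ y ∈ Ψ i, x ≠ y → pref i x y ∨ pref i y x)
    (hleast : ∀ i, ∀ x ∈ Ψ i, x ≠ 0 → pref i x 0)
    (D : Fin n → (Fin m → ℝ) → ℝ → Bundle m)
    (hD : ∀ (i : Fin n) (p : Fin m → ℝ) (b : ℝ), (∀ j, 0 ≤ p j) → 0 ≤ b →
        D i p b ∈ Ψ i ∧ dotp p (D i p b) ≤ b ∧
        ∀ x ∈ Ψ i, dotp p x ≤ b → x = D i p b ∨ pref i (D i p b) x)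
    -- a feasible lottery allocation
    (xt : Fin n → Bundle m → ℝ)
    (hx_nonneg : ∀ i x, 0 ≤ xt i x)
    (hx_supp : ∀ i x, x ∉ Ψ i → xt i x = 0)
    (hx_sum : ∀ i, ∑ x ∈ Ψ i, xt i x = 1)
    (hx_feas : ∀ j, ∑ i, ∑ x ∈ Ψ i, xt i x * (x j : ℝ) ≤ (c j : ℝ)) :
    -- CERI allocation ...
    ((∃ (B : Fin n → Measure ℝ) (p : Fin m → ℝ),
        (∀ i, IsProbabilityMeasure (B i)) ∧
        (∀ i, B i {b | b < 0} = 0) ∧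
        (∀ j, 0 ≤ p j) ∧
        (∀ j, ∑ i, ∑ x ∈ Ψ i, (B i {b | D i p b = x}).toReal * (x j : ℝ) ≤ (c j : ℝ)) ∧
        (∀ j, 0 < p j →
          ∑ i, ∑ x ∈ Ψ i, (B i {b | D i p b = x}).toReal * (x j : ℝ) = (c j : ℝ)) ∧
        (∀ i, ∀ x ∈ Ψ i, xt i x = (B i {b | D i p b = x}).toReal))
      ↔
    -- ... iff supporting prices exist
      (∃ p : Fin m → ℝ,
        (∀ j, 0 ≤ p j) ∧
        (∀ j, ∑ i, ∑ x ∈ Ψ i, xt i x * (x j : ℝ) < (c j : ℝ) → p j = 0) ∧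
        (∀ i, ∀ x ∈ Ψ i, 0 < xt i x → ∀ y ∈ Ψ i, pref i y x →
          1 ≤ dotp p y - dotp p x))) := by
  classical
  constructor
  · rintro ⟨B, p, -, hneg, hp, -, hclear, hxt⟩
    have hgap : ∀ i, ∀ x ∈ Ψ i, 0 < xt i x → ∀ y ∈ Ψ i, pref i y x → 0 < dotp p y - dotp p x := by
      intro i x hx hpos y hy hyx
      obtain ⟨b, hb, hb0⟩ : ∃ b, D i p b = x ∧ 0 ≤ b := by
        by_contra! hcon
        have hnull : B i {b | D i p b = x} = 0 := measure_mono_null hcon (hneg i)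
        rw [hxt i x hx, hnull] at hpos
        simp at hpos
      obtain ⟨-, hle, hbest⟩ := hD i p b hp hb0
      rw [hb] at hle hbest
      by_contra! hcon
      rcases hbest y hy (by linarith) with rfl | hxy
      · exact hirr i y hy hyx
      · exact hirr i x hx (htrans i x hx y hy x hx hxy hyx)
    obtain ⟨t, ht, hscale⟩ := exists_nonneg_scale_of_finset
      (Finset.univ.biUnion fun i => (Ψ i ×ˢ Ψ i).image fun q => dotp p q.2 - dotp p q.1)
    refine ⟨fun j => t * p j, fun j => mul_nonneg ht (hp j), fun j hj => ?_, ?_⟩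
    · have hpj : p j = 0 := by
        by_contra hne
        have heq := hclear j ((hp j).lt_of_ne' hne)
        refine hj.ne (Eq.trans ?_ heq)
        exact Finset.sum_congr rfl fun i _ => Finset.sum_congr rfl fun x hx => by rw [hxt i x hx]
      simp [hpj]
    · intro i x hx hpos y hy hyx
      rw [dotp_const_mul, dotp_const_mul, ← mul_sub]
      refine hscale _ ?_ (hgap i x hx hpos y hy hyx)
      exact Finset.mem_biUnion.2 ⟨i, Finset.mem_univ i,
        Finset.mem_image.2 ⟨(x, y), Finset.mk_mem_product hx hy, rfl⟩⟩
  · rintro ⟨p, hp, hunder, hgap⟩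
    have hdem : ∀ i, ∀ x ∈ Ψ i, 0 < xt i x → D i p (dotp p x) = x := by
      intro i x hx hpos
      obtain ⟨hmem, hle, hbest⟩ := hD i p (dotp p x) hp (dotp_nonneg hp x)
      rcases hbest x hx le_rfl with h | h
      · exact h.symm
      · linarith [hgap i x hx hpos _ hmem h]
    let B : Fin n → Measure ℝ := fun i => weightedDirac (Ψ i) (xt i) (dotp p)
    have hB : ∀ i, ∀ z ∈ Ψ i, xt i z = (B i {b | D i p b = z}).toReal := by
      intro i z hz
      have hterm : ∀ x ∈ Ψ i, (if dotp p x ∈ {b | D i p b = z} then ENNReal.ofReal (xt i x) else 0)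
          = if x = z then ENNReal.ofReal (xt i x) else 0 := by
        intro x hx
        rcases (hx_nonneg i x).eq_or_lt with h | h
        · simp [← h]
        · simp [hdem i x hx h]
      simp only [B]
      rw [weightedDirac_apply, Finset.sum_congr rfl hterm, Finset.sum_ite_eq' (Ψ i) z, if_pos hz,
        ENNReal.toReal_ofReal (hx_nonneg i z)]
    have hE : ∀ j, ∑ i, ∑ x ∈ Ψ i, (B i {b | D i p b = x}).toReal * (x j : ℝ)
        = ∑ i, ∑ x ∈ Ψ i, xt i x * (x j : ℝ) := fun j =>
      Finset.sum_congr rfl fun i _ => Finset.sum_congr rfl fun x hx => by rw [← hB i x hx]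
    refine ⟨B, p, fun i => ⟨?_⟩, fun i => ?_, hp, fun j => ?_, fun j hj => ?_, hB⟩
    · simp only [B]
      rw [weightedDirac_apply]
      simp [← ENNReal.ofReal_sum_of_nonneg fun x _ => hx_nonneg i x, hx_sum i]
    · simp only [B]
      rw [weightedDirac_apply]
      exact Finset.sum_eq_zero fun x _ => if_neg (dotp_nonneg hp x).not_gt
    · rw [hE]
      exact hx_feas j
    · rw [hE]
      by_contra hne
      exact hj.ne' (hunder j ((hx_feas j).lt_of_ne hne))
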